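/- arXiv:2002.01826 — 2 statements merged into one kernel-verified Lean document; each statement's English description precedes it below -/
import Mathlib

section
/- Let p > 2, K ≥ 3, and fix θ with 1 < θ < min(p−1, 3/2). Let σ₁, …, σ_K ∈ {−1, 1} and z₁ < … < z_K be real numbers; set Q_k(x) = σ_k·Q(x − z_k), R = Σ_{k=1}^K Q_k and G = f(R) − Σ_{k=1}^K f(Q_k), where f(u) = |u|^(p−1)·u. Let c₁ = ∫_ℝ (Q')² and κ = (c_Q/c₁)·∫_ℝ Q(x)^p·e^(−x) dx with c_Q = (2p+2)^(1/(p−1)). There exist constants C > 0 and r₀ > 0, depending only on p, K and θ, such that if z_{l+1} − z_l ≥ r₀ for all l, then for every k ∈ {2, …, K−1}: |∫_ℝ G(x)·(∂_x Q_k)(x) dx − c₁·κ·σ_k·(σ_{k−1}·e^(−(z_k−z_{k−1})) − σ_{k+1}·e^(−(z_{k+1}−z_k)))| ≤ C·Σ_{l=1}^{K−1} e^(−θ·(z_{l+1}−z_l)). -/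
open MeasureTheory

/-- The ground state of the one-dimensional nonlinear Klein-Gordon equation. -/
noncomputable def Q (p : ℝ) (x : ℝ) : ℝ :=
  ((p + 1) / (2 * Real.cosh ((p - 1) / 2 * x) ^ 2)) ^ (1 / (p - 1))

/-- The focusing nonlinearity `f(u) = |u|^{p-1} u`. -/
noncomputable def f (p u : ℝ) : ℝ := |u| ^ (p - 1) * u

/-- The constant `c_Q = (2p+2)^(1/(p-1))`. -/
noncomputable def cQ (p : ℝ) : ℝ := (2 * p + 2) ^ (1 / (p - 1))

/-- The constant `c₁ = ∫ (Q')²`. -/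
noncomputable def c₁ (p : ℝ) : ℝ := ∫ x : ℝ, deriv (Q p) x ^ 2

/-- The interaction constant `κ = (c_Q/c₁) ∫ Q^p e^{-x}`. -/
noncomputable def κ (p : ℝ) : ℝ := cQ p / c₁ p * ∫ x : ℝ, Q p x ^ p * Real.exp (-x)

lemma Q_eq {p : ℝ} (hp : 1 < p) (x : ℝ) :
    Q p x = cQ p * Real.exp x * (1 + Real.exp ((p - 1) * x)) ^ (-2 / (p - 1)) := by
  have hp0 : p - 1 ≠ 0 := by linarith
  have hE : Real.exp ((p - 1) * x) = Real.exp ((p - 1) / 2 * x) ^ 2 := by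
    rw [← Real.exp_nat_mul]; congr 1; push_cast; ring
  have hpos : 0 < 1 + Real.exp ((p - 1) * x) := by positivity
  have hbase : (p + 1) / (2 * Real.cosh ((p - 1) / 2 * x) ^ 2)
      = (2 * p + 2) * Real.exp ((p - 1) * x) * (1 + Real.exp ((p - 1) * x)) ^ (-2 : ℝ) := by
    rw [Real.rpow_neg hpos.le, Real.rpow_two, Real.cosh_eq, hE, Real.exp_neg]
    have h := Real.exp_pos ((p - 1) / 2 * x)
    field_simp
    ring
  have hrp : Real.exp ((p - 1) * x) ^ (1 / (p - 1)) = Real.exp x := by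
    rw [← Real.exp_mul]; congr 1; field_simp
  rw [Q, cQ, hbase, Real.mul_rpow (by positivity) (by positivity),
    Real.mul_rpow (by linarith) (by positivity), hrp, ← Real.rpow_mul hpos.le]
  congr 2
  ring

lemma cQ_pos {p : ℝ} (hp : 1 < p) : 0 < cQ p :=
  Real.rpow_pos_of_pos (by linarith) _

lemma Q_pos {p : ℝ} (hp : 1 < p) (x : ℝ) : 0 < Q p x := by
  rw [Q_eq hp]
  have := cQ_pos hp
  positivity

lemma Q_neg (p x : ℝ) : Q p (-x) = Q p x := by
  simp [Q]

lemma Q_le_exp {p : ℝ} (hp : 1 < p) (x : ℝ) : Q p x ≤ cQ p * Real.exp x := by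
  rw [Q_eq hp]
  have hc := cQ_pos hp
  refine mul_le_of_le_one_right (by positivity) ?_
  refine Real.rpow_le_one_of_one_le_of_nonpos ?_ (div_nonpos_of_nonpos_of_nonneg (by norm_num)
    (by linarith))
  linarith [Real.exp_pos ((p - 1) * x)]

lemma Q_le_exp_neg_abs {p : ℝ} (hp : 1 < p) (x : ℝ) : Q p x ≤ cQ p * Real.exp (-|x|) := by
  rcases abs_cases x with ⟨h, _⟩ | ⟨h, _⟩ <;> rw [h]
  · rw [← Q_neg]; exact Q_le_exp hp _
  · rw [neg_neg]; exact Q_le_exp hp _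

/-- The tail of the ground state is `c_Q e^x` up to an error of any intermediate order. -/
lemma abs_Q_sub_exp_le {p θ : ℝ} (hp : 1 < p) (hθ1 : 1 ≤ θ) (hθ2 : θ ≤ p) (x : ℝ) :
    |Q p x - cQ p * Real.exp x| ≤ cQ p * (1 + 2 / (p - 1)) * Real.exp (θ * x) := by
  have hc := cQ_pos hp
  have hp1 : 0 < p - 1 := by linarith
  have hQ := Q_le_exp hp x
  have hQ0 := Q_pos hp x
  rw [abs_sub_comm, abs_of_nonneg (by linarith)]
  have h2 : 0 < 2 / (p - 1) := by positivity
  rcases le_total 0 x with hx | hx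
  · have : Real.exp x ≤ Real.exp (θ * x) := Real.exp_le_exp.2 (by nlinarith)
    calc cQ p * Real.exp x - Q p x ≤ cQ p * Real.exp x := by linarith
      _ ≤ cQ p * Real.exp (θ * x) := by gcongr
      _ ≤ _ := by
        rw [mul_assoc]
        gcongr
        nlinarith [Real.exp_pos (θ * x)]
  · set E := Real.exp ((p - 1) * x) with hE
    have hEpos : 0 < E := Real.exp_pos _
    have hlow : 1 - 2 / (p - 1) * E ≤ (1 + E) ^ (-2 / (p - 1)) := by
      rw [Real.rpow_def_of_pos (by positivity)]
      have h1 := Real.add_one_le_exp (Real.log (1 + E) * (-2 / (p - 1)))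
      have h3 : Real.log (1 + E) ≤ E := by
        have := Real.log_le_sub_one_of_pos (show 0 < 1 + E by positivity)
        linarith
      have h4 : Real.log (1 + E) * (-2 / (p - 1)) = -(2 / (p - 1) * Real.log (1 + E)) := by ring
      have h5 := mul_le_mul_of_nonneg_left h3 h2.le
      linarith
    have hexp : Real.exp x * E ≤ Real.exp (θ * x) := by
      rw [hE, ← Real.exp_add]
      exact Real.exp_le_exp.2 (by nlinarith)
    rw [Q_eq hp, ← hE]
    calc cQ p * Real.exp x - cQ p * Real.exp x * (1 + E) ^ (-2 / (p - 1))
        = cQ p * Real.exp x * (1 - (1 + E) ^ (-2 / (p - 1))) := by ring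
      _ ≤ cQ p * Real.exp x * (2 / (p - 1) * E) := by gcongr; linarith
      _ = cQ p * (2 / (p - 1)) * (Real.exp x * E) := by ring
      _ ≤ cQ p * (2 / (p - 1)) * Real.exp (θ * x) := by gcongr
      _ ≤ _ := by gcongr; linarith

lemma hasDerivAt_Q {p : ℝ} (hp : 1 < p) (x : ℝ) :
    HasDerivAt (Q p)
      (Q p x * ((1 - Real.exp ((p - 1) * x)) / (1 + Real.exp ((p - 1) * x)))) x := by
  have hp0 : p - 1 ≠ 0 := by linarith
  have hpos : 0 < 1 + Real.exp ((p - 1) * x) := by positivity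
  have h1 : HasDerivAt (fun y => 1 + Real.exp ((p - 1) * y))
      (Real.exp ((p - 1) * x) * (p - 1)) x := by
    simpa using (((hasDerivAt_id x).const_mul (p - 1)).exp).const_add 1
  have h2 := h1.rpow_const (p := -2 / (p - 1)) (Or.inl hpos.ne')
  have h3 := ((Real.hasDerivAt_exp x).const_mul (cQ p)).mul h2
  refine (h3.congr_of_eventuallyEq (Filter.Eventually.of_forall fun y => ?_)).congr_deriv ?_
  · exact Q_eq hp y
  · rw [Q_eq hp, Real.rpow_sub_one hpos.ne']
    field_simp
    ring

lemma deriv_Q {p : ℝ} (hp : 1 < p) (x : ℝ) : deriv (Q p) x =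
    Q p x * ((1 - Real.exp ((p - 1) * x)) / (1 + Real.exp ((p - 1) * x))) :=
  (hasDerivAt_Q hp x).deriv

lemma abs_deriv_Q_le {p : ℝ} (hp : 1 < p) (x : ℝ) : |deriv (Q p) x| ≤ Q p x := by
  have hE := Real.exp_pos ((p - 1) * x)
  rw [deriv_Q hp, abs_mul, abs_of_pos (Q_pos hp x)]
  refine mul_le_of_le_one_right (Q_pos hp x).le ?_
  rw [abs_div, abs_of_pos (show 0 < 1 + Real.exp ((p - 1) * x) by positivity),
    div_le_one (by positivity), abs_le]
  constructor <;> linarith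

lemma continuous_Q {p : ℝ} (hp : 1 < p) : Continuous (Q p) :=
  continuous_iff_continuousAt.2 fun x => (hasDerivAt_Q hp x).continuousAt

lemma continuous_deriv_Q {p : ℝ} (hp : 1 < p) : Continuous (deriv (Q p)) := by
  rw [funext (deriv_Q hp)]
  have := continuous_Q hp
  have h : ∀ x, 1 + Real.exp ((p - 1) * x) ≠ 0 := fun x => by positivity
  fun_prop (disch := exact h _)

lemma integrable_exp_neg_mul_abs {b : ℝ} (hb : 0 < b) :
    Integrable fun x : ℝ => Real.exp (-b * |x|) := by
  rw [← integrableOn_univ, ← Set.Iic_union_Ioi (a := (0 : ℝ))]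
  refine IntegrableOn.union ?_ ?_
  · refine (integrableOn_exp_mul_Iic hb 0).congr_fun (fun x hx => ?_) measurableSet_Iic
    simp [abs_of_nonpos (Set.mem_Iic.1 hx)]
  · refine (integrableOn_exp_mul_Ioi (neg_neg_of_pos hb) 0).congr_fun (fun x hx => ?_)
      measurableSet_Ioi
    simp [abs_of_pos (Set.mem_Ioi.1 hx)]

lemma c₁_pos {p : ℝ} (hp : 1 < p) : 0 < c₁ p := by
  have hcont : Continuous fun x => deriv (Q p) x ^ 2 := (continuous_deriv_Q hp).pow 2
  have hint : Integrable fun x => deriv (Q p) x ^ 2 := by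
    refine ((integrable_exp_neg_mul_abs (b := 2) (by norm_num)).const_mul (cQ p ^ 2)).mono'
      hcont.aestronglyMeasurable (Filter.Eventually.of_forall fun x => ?_)
    have h := (abs_deriv_Q_le hp x).trans (Q_le_exp_neg_abs hp x)
    rw [Real.norm_eq_abs, abs_of_nonneg (sq_nonneg _), ← sq_abs]
    calc |deriv (Q p) x| ^ 2 ≤ (cQ p * Real.exp (-|x|)) ^ 2 := by gcongr
      _ = _ := by rw [mul_pow, ← Real.exp_nat_mul]; congr 2; push_cast; ring
  have hne : deriv (Q p) 1 ≠ 0 := by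
    rw [deriv_Q hp]
    have h1 : 1 < Real.exp ((p - 1) * 1) := Real.one_lt_exp_iff.2 (by linarith)
    exact mul_ne_zero (Q_pos hp 1).ne' (div_ne_zero (by linarith) (by positivity))
  exact integral_pos_of_integrable_nonneg_nonzero hcont hint (fun x => sq_nonneg _)
    (pow_ne_zero 2 hne)

lemma hasDerivAt_f {p : ℝ} (hp : 2 < p) (u : ℝ) :
    HasDerivAt (f p) (p * |u| ^ (p - 1)) u := by
  have h := (hasDerivAt_abs_rpow u (p := p - 1) (by linarith)).mul (hasDerivAt_id u)
  refine h.congr_deriv ?_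
  rcases eq_or_ne u 0 with rfl | hu
  · simp [Real.zero_rpow (show p - 1 ≠ 0 by linarith)]
  · have hu' : 0 < |u| := abs_pos.2 hu
    have : |u| ^ (p - 1) = |u| ^ (p - 1 - 2) * u ^ 2 := by
      rw [← sq_abs, ← Real.rpow_two, ← Real.rpow_add hu']; congr 1; ring
    simp only [id, this]
    ring

lemma abs_f {p : ℝ} (hp : 0 < p) (u : ℝ) : |f p u| = |u| ^ p := by
  rcases eq_or_ne u 0 with rfl | hu
  · simp [f, Real.zero_rpow hp.ne']
  · rw [f, abs_mul, Real.abs_rpow_of_nonneg (abs_nonneg u), abs_abs,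
      ← Real.rpow_add_one (abs_pos.2 hu).ne', sub_add_cancel]

lemma abs_f_add_sub_le {p : ℝ} (hp : 2 < p) (a b : ℝ) :
    |f p (a + b) - f p a| ≤ p * (|a| + |b|) ^ (p - 1) * |b| := by
  have h := (convex_Icc (-(|a| + |b|)) (|a| + |b|)).norm_image_sub_le_of_norm_hasDerivWithin_le
    (f := f p) (x := a) (y := a + b) (C := p * (|a| + |b|) ^ (p - 1))
    (fun u _ => (hasDerivAt_f hp u).hasDerivWithinAt) (fun u hu => ?_)
    (abs_le.1 (le_add_of_nonneg_right (abs_nonneg b))) (abs_le.1 (abs_add_le a b))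
  · simpa [Real.norm_eq_abs] using h
  · have := abs_le.2 hu
    rw [Real.norm_of_nonneg (by positivity)]
    gcongr
    linarith

lemma abs_rpow_sub_le {p : ℝ} (hp : 2 < p) (a b : ℝ) :
    |(|a + b| ^ (p - 1) - |a| ^ (p - 1))| ≤ (p - 1) * (|a| + |b|) ^ (p - 2) * |b| := by
  have h := (convex_Icc (-(|a| + |b|)) (|a| + |b|)).norm_image_sub_le_of_norm_hasDerivWithin_le
    (x := a) (y := a + b) (C := (p - 1) * (|a| + |b|) ^ (p - 2))
    (fun u _ => (hasDerivAt_abs_rpow u (p := p - 1) (by linarith)).hasDerivWithinAt)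
    (fun u hu => ?_)
    (abs_le.1 (le_add_of_nonneg_right (abs_nonneg b))) (abs_le.1 (abs_add_le a b))
  · simpa [Real.norm_eq_abs] using h
  · have hu' := abs_le.2 hu
    have hp1 : 0 < p - 1 := by linarith
    rw [norm_mul, norm_mul, Real.norm_of_nonneg hp1.le, Real.norm_of_nonneg (by positivity),
      Real.norm_eq_abs, mul_assoc]
    gcongr
    rcases eq_or_ne u 0 with rfl | hu0
    · simp only [abs_zero, mul_zero]; positivity
    · rw [← Real.rpow_add_one (abs_pos.2 hu0).ne', show p - 1 - 2 + 1 = p - 2 by ring]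
      exact Real.rpow_le_rpow (abs_nonneg u) hu' (by linarith)

lemma abs_f_add_sub_linear_le {p : ℝ} (hp : 2 < p) (a b : ℝ) :
    |f p (a + b) - f p a - p * |a| ^ (p - 1) * b|
      ≤ p * (p - 1) * (|a| + |b|) ^ (p - 2) * b ^ 2 := by
  have hp1 : 0 < p - 1 := by linarith
  have h := (convex_Icc (-|b|) |b|).norm_image_sub_le_of_norm_hasDerivWithin_le
    (f := fun t => f p (a + t) - p * |a| ^ (p - 1) * t) (x := 0) (y := b)
    (f' := fun t => p * |a + t| ^ (p - 1) - p * |a| ^ (p - 1))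
    (C := p * (p - 1) * (|a| + |b|) ^ (p - 2) * |b|)
    (fun t _ => ?_) (fun t ht => ?_) (by simp) (abs_le.1 le_rfl)
  · have e : p * (p - 1) * (|a| + |b|) ^ (p - 2) * b ^ 2
        = p * (p - 1) * (|a| + |b|) ^ (p - 2) * |b| * ‖b - 0‖ := by
      rw [sub_zero, Real.norm_eq_abs, ← sq_abs]; ring
    rw [e]
    refine le_trans (le_of_eq ?_) h
    rw [Real.norm_eq_abs]
    congr 1
    simp
    ring
  · have h1 : HasDerivAt (fun t => f p (a + t)) (p * |a + t| ^ (p - 1)) t :=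
      (hasDerivAt_f hp (a + t)).comp_const_add a t
    have h2 : HasDerivAt (fun t => p * |a| ^ (p - 1) * t) (p * |a| ^ (p - 1)) t := by
      simpa using (hasDerivAt_id t).const_mul (p * |a| ^ (p - 1))
    exact (h1.sub h2).hasDerivWithinAt
  · have ht' : |t| ≤ |b| := abs_le.2 ht
    rw [← mul_sub, norm_mul, Real.norm_of_nonneg (by linarith), Real.norm_eq_abs]
    calc p * |(|a + t| ^ (p - 1) - |a| ^ (p - 1))|
        ≤ p * ((p - 1) * (|a| + |t|) ^ (p - 2) * |t|) := by
          gcongr; exact abs_rpow_sub_le hp a t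
      _ ≤ p * ((p - 1) * (|a| + |b|) ^ (p - 2) * |b|) := by
          have : 0 ≤ p - 2 := by linarith
          gcongr
      _ = _ := by ring

lemma abs_sum_erase_le (s : Finset ℕ) (a : ℕ → ℝ) {m : ℕ} {U : ℝ} (hU : 0 ≤ U)
    (h : ∀ j ∈ s, |a j| ≤ U) : |∑ j ∈ s.erase m, a j| ≤ s.card * U := by
  refine (Finset.abs_sum_le_sum_abs _ _).trans ?_
  refine (Finset.sum_le_card_nsmul _ _ U fun j hj => h j (Finset.mem_of_mem_erase hj)).trans ?_
  rw [nsmul_eq_mul]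
  gcongr
  exact Finset.erase_subset _ _

lemma sum_erase_le (s : Finset ℕ) (a : ℕ → ℝ) {m : ℕ} {U : ℝ} (hU : 0 ≤ U)
    (h : ∀ j ∈ s, j ≠ m → a j ≤ U) : ∑ j ∈ s.erase m, a j ≤ s.card * U := by
  refine (Finset.sum_le_card_nsmul _ _ U fun j hj =>
    h j (Finset.mem_of_mem_erase hj) (Finset.ne_of_mem_erase hj)).trans ?_
  rw [nsmul_eq_mul]
  gcongr
  exact Finset.erase_subset _ _

/-- If the products of distinct summands are small, then after multiplication by the `k`-th
summand `f` of the sum is given by its linearization at the `k`-th summand plus the sum of the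
self-interactions. -/
lemma abs_f_sum_sub_linear_mul_le {p : ℝ} (hp : 2 < p) (K : ℕ) :
    ∃ C > 0, ∀ (s : Finset ℕ) (a : ℕ → ℝ) (k : ℕ) (B : ℝ), s.card = K → k ∈ s → 0 ≤ B →
      (∀ j ∈ s, j ≠ k → |a k| ^ (p - 1) * |a j| ^ 2 ≤ B) →
      (∀ j ∈ s, j ≠ k → |a j| ^ (p - 1) * |a k| ^ 2 ≤ B) →
      (∀ i ∈ s, ∀ j ∈ s, i ≠ k → j ≠ k → i ≠ j → |a i| ^ (p - 1) * |a j| * |a k| ≤ B) →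
      |f p (∑ j ∈ s, a j) - ∑ j ∈ s, f p (a j) - p * |a k| ^ (p - 1) * ∑ j ∈ s.erase k, a j| *
        |a k| ≤ C * B := by
  have hp2 : 0 < p - 2 := by linarith
  have hp1 : 0 < p - 1 := by linarith
  have hrpow_mul : ∀ u : ℝ, 0 ≤ u → u ^ p = u ^ (p - 1) * u := by
    intro u hu
    rcases hu.eq_or_lt with rfl | hu
    · simp [Real.zero_rpow (show p ≠ 0 by linarith)]
    · rw [← Real.rpow_add_one hu.ne', sub_add_cancel]
  have hrpow_mul' : ∀ u : ℝ, 0 ≤ u → u ^ (p - 1) = u ^ (p - 2) * u := by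
    intro u hu
    rcases hu.eq_or_lt with rfl | hu
    · simp [Real.zero_rpow hp1.ne']
    · rw [← Real.rpow_add_one hu.ne']; congr 1; ring
  refine ⟨p * (p - 1) * (1 + K) ^ (p - 2) * K ^ 2 + p * (1 + K) ^ (p - 1) * K + p * K + K + 1,
    by positivity, ?_⟩
  intro s a k B hcard hk hB h1 h2 h3
  obtain ⟨m, hm, hmax⟩ := Finset.exists_max_image s (fun j => |a j|) ⟨k, hk⟩
  set u : ℕ → ℝ := fun j => |a j| with hu
  have hu0 : ∀ j, 0 ≤ u j := fun j => abs_nonneg _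
  have hS : |∑ j ∈ s.erase m, a j| ≤ K * u m := by
    simpa [hcard] using abs_sum_erase_le s a (m := m) (hu0 m) hmax
  have hSsum : |∑ j ∈ s.erase m, a j| ≤ ∑ j ∈ s.erase m, u j := Finset.abs_sum_le_sum_abs _ _
  have hsplit : ∑ j ∈ s, a j = a m + ∑ j ∈ s.erase m, a j := (Finset.add_sum_erase s a hm).symm
  have hsplitf : ∑ j ∈ s, f p (a j) = f p (a m) + ∑ j ∈ s.erase m, f p (a j) :=
    (Finset.add_sum_erase s _ hm).symm
  have hself : |∑ j ∈ s.erase m, f p (a j)| * u k ≤ K * B := by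
    calc |∑ j ∈ s.erase m, f p (a j)| * u k ≤ (∑ j ∈ s.erase m, |f p (a j)|) * u k := by
          gcongr; exact Finset.abs_sum_le_sum_abs _ _
      _ = ∑ j ∈ s.erase m, |f p (a j)| * u k := Finset.sum_mul _ _ _
      _ ≤ s.card * B := by
          refine sum_erase_le s _ hB fun j hj hjm => ?_
          rw [abs_f (by linarith), hrpow_mul _ (abs_nonneg _)]
          rcases eq_or_ne j k with rfl | hjk
          · calc |a j| ^ (p - 1) * |a j| * u j = u j ^ (p - 1) * u j ^ 2 := by simp only [hu]; ring
              _ ≤ u m ^ (p - 1) * u j ^ 2 := by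
                have := hmax j hj
                have := hu0 j
                gcongr
              _ ≤ B := h2 m hm hjm.symm
          · rcases eq_or_ne m k with rfl | hmk
            · have h := hmax j hj
              calc |a j| ^ (p - 1) * |a j| * u m = u j ^ (p - 2) * u m * u j ^ 2 := by
                    rw [hrpow_mul' _ (abs_nonneg _)]; simp only [hu]; ring
                _ ≤ u m ^ (p - 2) * u m * u j ^ 2 := by have := hu0 m; have := hu0 j; gcongr
                _ = u m ^ (p - 1) * u j ^ 2 := by rw [hrpow_mul' _ (hu0 m)]
                _ ≤ B := h1 j hj hjk
            · refine le_trans ?_ (h3 m hm j hj hmk hjk hjm.symm)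
              exact mul_le_mul_of_nonneg_right (mul_le_mul_of_nonneg_right
                (Real.rpow_le_rpow (hu0 j) (hmax j hj) hp1.le) (hu0 j)) (hu0 k)
      _ = K * B := by rw [hcard]
  rcases eq_or_ne m k with rfl | hmk
  · have hlin := abs_f_add_sub_linear_le hp (a m) (∑ j ∈ s.erase m, a j)
    set S := ∑ j ∈ s.erase m, a j with hSdef
    have hsq : u m ^ (p - 1) * S ^ 2 ≤ K ^ 2 * B := by
      calc u m ^ (p - 1) * S ^ 2 ≤ u m ^ (p - 1) * (K * ∑ j ∈ s.erase m, u j ^ 2) := by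
            have := hu0 m
            gcongr
            calc S ^ 2 = |S| ^ 2 := (sq_abs _).symm
              _ ≤ (∑ j ∈ s.erase m, u j) ^ 2 := by gcongr
              _ ≤ (s.erase m).card * ∑ j ∈ s.erase m, u j ^ 2 := sq_sum_le_card_mul_sum_sq
              _ ≤ _ := by
                rw [← hcard]; gcongr; exact Finset.erase_subset _ _
        _ = K * ∑ j ∈ s.erase m, u m ^ (p - 1) * u j ^ 2 := by rw [← Finset.mul_sum]; ring
        _ ≤ K * (s.card * B) := by
            gcongr
            exact sum_erase_le s _ hB fun j hj hjm => h1 j hj hjm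
        _ = _ := by rw [hcard]; ring
    have hmain : p * (p - 1) * (|a m| + |S|) ^ (p - 2) * S ^ 2 * u m
        ≤ p * (p - 1) * (1 + K) ^ (p - 2) * K ^ 2 * B := by
      calc p * (p - 1) * (|a m| + |S|) ^ (p - 2) * S ^ 2 * u m
          ≤ p * (p - 1) * ((1 + K) * u m) ^ (p - 2) * S ^ 2 * u m := by
            have := hu0 m
            gcongr
            rw [add_mul, one_mul]
            gcongr
        _ = p * (p - 1) * (1 + K) ^ (p - 2) * (u m ^ (p - 1) * S ^ 2) := by
            rw [Real.mul_rpow (by positivity) (hu0 m), hrpow_mul' _ (hu0 m)]; ring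
        _ ≤ p * (p - 1) * (1 + K) ^ (p - 2) * (K ^ 2 * B) := by gcongr
        _ = _ := by ring
    rw [hsplit, hsplitf]
    calc |f p (a m + S) - (f p (a m) + ∑ j ∈ s.erase m, f p (a j))
            - p * |a m| ^ (p - 1) * S| * |a m|
        ≤ (|f p (a m + S) - f p (a m) - p * |a m| ^ (p - 1) * S|
            + |∑ j ∈ s.erase m, f p (a j)|) * u m := by
          gcongr
          refine le_trans (le_of_eq ?_) (abs_sub _ _)
          congr 1; ring
      _ ≤ p * (p - 1) * (|a m| + |S|) ^ (p - 2) * S ^ 2 * u m + K * B := by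
          rw [add_mul]
          have := hu0 m
          gcongr
      _ ≤ p * (p - 1) * (1 + K) ^ (p - 2) * K ^ 2 * B + K * B := by gcongr
      _ ≤ _ := by
          have e1 : 0 ≤ p * (1 + K) ^ (p - 1) * K * B := by positivity
          have e2 : 0 ≤ p * K * B := by positivity
          linarith
  · have hinc := abs_f_add_sub_le hp (a m) (∑ j ∈ s.erase m, a j)
    set S := ∑ j ∈ s.erase m, a j with hSdef
    have hmain : p * (|a m| + |S|) ^ (p - 1) * |S| * u k ≤ p * (1 + K) ^ (p - 1) * K * B := by
      calc p * (|a m| + |S|) ^ (p - 1) * |S| * u k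
          ≤ p * ((1 + K) * u m) ^ (p - 1) * (∑ j ∈ s.erase m, u j) * u k := by
            have := hu0 k
            gcongr
            rw [add_mul, one_mul]
            gcongr
        _ = p * (1 + K) ^ (p - 1) * ∑ j ∈ s.erase m, u m ^ (p - 1) * u j * u k := by
            rw [← Finset.sum_mul, ← Finset.mul_sum, Real.mul_rpow (by positivity) (hu0 m)]; ring
        _ ≤ p * (1 + K) ^ (p - 1) * (s.card * B) := by
            gcongr
            refine sum_erase_le s _ hB fun j hj hjm => ?_
            rcases eq_or_ne j k with rfl | hjk
            · exact le_trans (le_of_eq (by simp only [hu]; ring)) (h2 m hm hmk)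
            · exact h3 m hm j hj hmk hjk hjm.symm
        _ = _ := by rw [hcard]; ring
    have hT : |∑ j ∈ s.erase k, a j| ≤ K * u m := by
      simpa [hcard] using abs_sum_erase_le s a (m := k) (hu0 m) hmax
    set T := ∑ j ∈ s.erase k, a j
    have hlin : |p * |a k| ^ (p - 1) * T| * u k ≤ p * K * B := by
      rw [abs_mul, abs_of_nonneg (show 0 ≤ p * |a k| ^ (p - 1) by positivity)]
      have := hu0 k
      have := hu0 m
      have := hmax k hk
      calc p * |a k| ^ (p - 1) * |T| * u k ≤ p * u k ^ (p - 1) * (K * u m) * u k := by gcongr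
        _ = p * K * (u k ^ (p - 2) * u m * u k ^ 2) := by rw [hrpow_mul' _ (hu0 k)]; ring
        _ ≤ p * K * (u m ^ (p - 2) * u m * u k ^ 2) := by gcongr
        _ = p * K * (u m ^ (p - 1) * u k ^ 2) := by rw [hrpow_mul' _ (hu0 m)]
        _ ≤ p * K * B := by gcongr; exact h2 m hm hmk
    rw [hsplit, hsplitf]
    calc |f p (a m + S) - (f p (a m) + ∑ j ∈ s.erase m, f p (a j))
            - p * |a k| ^ (p - 1) * T| * |a k|
        ≤ (|f p (a m + S) - f p (a m)| + |∑ j ∈ s.erase m, f p (a j)|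
            + |p * |a k| ^ (p - 1) * T|) * u k := by
          gcongr
          refine le_trans ?_ ((abs_sub _ _).trans (add_le_add_left (abs_sub _ _) _))
          exact le_of_eq (by congr 1; ring)
      _ ≤ p * (|a m| + |S|) ^ (p - 1) * |S| * u k + K * B + p * K * B := by
          rw [add_mul, add_mul]
          have := hu0 k
          gcongr
      _ ≤ p * (1 + K) ^ (p - 1) * K * B + K * B + p * K * B := by gcongr
      _ ≤ _ := by
          have e1 : 0 ≤ p * (p - 1) * (1 + K) ^ (p - 2) * K ^ 2 * B := by positivity
          linarith

lemma Q_rpow_mul_mul_le {p : ℝ} (hp : 1 < p) (x y w : ℝ) :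
    Q p x ^ (p - 1) * (Q p y * Q p w)
      ≤ cQ p ^ (p + 1) * Real.exp (-((p - 1) * |x| + |y| + |w|)) := by
  have hc := cQ_pos hp
  have hp1 : 0 < p - 1 := by linarith
  calc Q p x ^ (p - 1) * (Q p y * Q p w)
      ≤ (cQ p * Real.exp (-|x|)) ^ (p - 1)
          * ((cQ p * Real.exp (-|y|)) * (cQ p * Real.exp (-|w|))) := by
        have := (Q_pos hp x).le
        have := (Q_pos hp y).le
        have := (Q_pos hp w).le
        gcongr <;> exact Q_le_exp_neg_abs hp _
    _ = (cQ p ^ (p - 1) * cQ p ^ (2 : ℝ))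
          * (Real.exp (-|x| * (p - 1)) * Real.exp (-|y|) * Real.exp (-|w|)) := by
        rw [Real.mul_rpow hc.le (Real.exp_pos _).le, ← Real.exp_mul, Real.rpow_two]; ring
    _ = _ := by
        rw [← Real.rpow_add hc, ← Real.exp_add, ← Real.exp_add]
        congr 2 <;> ring

lemma Q_rpow_le {p : ℝ} (hp : 1 < p) (x : ℝ) :
    Q p x ^ p ≤ cQ p ^ p * Real.exp (-p * |x|) := by
  have hc := cQ_pos hp
  calc Q p x ^ p ≤ (cQ p * Real.exp (-|x|)) ^ p :=
        Real.rpow_le_rpow (Q_pos hp x).le (Q_le_exp_neg_abs hp x) (by linarith)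
    _ = _ := by
        rw [Real.mul_rpow hc.le (Real.exp_pos _).le, ← Real.exp_mul]
        congr 2; ring

lemma hasDerivAt_Q_rpow {p : ℝ} (hp : 1 < p) (x : ℝ) :
    HasDerivAt (fun y => Q p y ^ p) (p * Q p x ^ (p - 1) * deriv (Q p) x) x := by
  refine ((hasDerivAt_Q hp x).rpow_const (p := p) (Or.inl (Q_pos hp x).ne')).congr_deriv ?_
  rw [deriv_Q hp]
  ring

lemma abs_deriv_Q_rpow_le {p : ℝ} (hp : 1 < p) (x : ℝ) :
    |p * Q p x ^ (p - 1) * deriv (Q p) x| ≤ p * Q p x ^ p := by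
  have hQ := Q_pos hp x
  rw [abs_mul, abs_of_pos (by positivity)]
  calc p * Q p x ^ (p - 1) * |deriv (Q p) x| ≤ p * Q p x ^ (p - 1) * Q p x := by
        gcongr; exact abs_deriv_Q_le hp x
    _ = _ := by rw [mul_assoc, ← Real.rpow_add_one hQ.ne', sub_add_cancel]

lemma integrable_exp_mul_of_le_Q_rpow {p s A : ℝ} (hp : 1 < p) (hs : |s| < p) (hA : 0 ≤ A)
    {g : ℝ → ℝ} (hg : Continuous g) (hgQ : ∀ x, |g x| ≤ A * Q p x ^ p) :
    Integrable fun x => Real.exp (s * x) * g x := by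
  refine ((integrable_exp_neg_mul_abs (b := p - |s|) (by linarith)).const_mul
    (A * cQ p ^ p)).mono' (by fun_prop) (Filter.Eventually.of_forall fun x => ?_)
  have hsx : s * x ≤ |s| * |x| := by rw [← abs_mul]; exact le_abs_self _
  have hc := cQ_pos hp
  rw [norm_mul, Real.norm_of_nonneg (Real.exp_pos _).le, Real.norm_eq_abs]
  calc Real.exp (s * x) * |g x|
      ≤ Real.exp (|s| * |x|) * (A * (cQ p ^ p * Real.exp (-p * |x|))) := by
        gcongr
        exact (hgQ x).trans (by gcongr; exact Q_rpow_le hp x)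
    _ = A * cQ p ^ p * (Real.exp (|s| * |x|) * Real.exp (-p * |x|)) := by ring
    _ = _ := by rw [← Real.exp_add]; congr 2; ring

lemma continuous_Q_rpow {p : ℝ} (hp : 1 < p) (r : ℝ) : Continuous fun x => Q p x ^ r :=
  (continuous_Q hp).rpow_const fun x => Or.inl (Q_pos hp x).ne'

lemma integrable_exp_mul_Q_rpow {p s : ℝ} (hp : 1 < p) (hs : |s| < p) :
    Integrable fun x => Real.exp (s * x) * Q p x ^ p :=
  integrable_exp_mul_of_le_Q_rpow hp hs zero_le_one (continuous_Q_rpow hp p) fun x => by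
    rw [abs_of_pos (Real.rpow_pos_of_pos (Q_pos hp x) _), one_mul]

lemma integrable_exp_mul_deriv_Q_rpow {p s : ℝ} (hp : 1 < p) (hs : |s| < p) :
    Integrable fun x => Real.exp (s * x) * (p * Q p x ^ (p - 1) * deriv (Q p) x) :=
  integrable_exp_mul_of_le_Q_rpow hp hs (by linarith)
    ((continuous_const.mul (continuous_Q_rpow hp _)).mul (continuous_deriv_Q hp))
    (abs_deriv_Q_rpow_le hp)

lemma integral_exp_mul_deriv_Q_rpow {p s : ℝ} (hp : 1 < p) (hs : |s| < p) :
    ∫ x, Real.exp (s * x) * (p * Q p x ^ (p - 1) * deriv (Q p) x)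
      = -(s * ∫ x, Real.exp (s * x) * Q p x ^ p) := by
  have h1 := integrable_exp_mul_Q_rpow hp hs
  have h := integral_mul_deriv_eq_deriv_mul_of_integrable
    (u := fun x => Real.exp (s * x)) (u' := fun x => s * Real.exp (s * x))
    (v := fun x => Q p x ^ p) (v' := fun x => p * Q p x ^ (p - 1) * deriv (Q p) x)
    (fun x _ => by simpa [mul_comm] using ((hasDerivAt_id x).const_mul s).exp)
    (fun x _ => hasDerivAt_Q_rpow hp x) (integrable_exp_mul_deriv_Q_rpow hp hs)
    ((h1.const_mul s).congr (Filter.Eventually.of_forall fun x => by simp [mul_assoc])) h1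
  rw [h, ← integral_const_mul]
  simp only [mul_assoc]

lemma integral_exp_mul_Q_rpow (p : ℝ) :
    ∫ x, Real.exp (1 * x) * Q p x ^ p = ∫ x, Q p x ^ p * Real.exp (-x) := by
  rw [← integral_neg_eq_self (fun x => Real.exp (1 * x) * Q p x ^ p)]
  simp [Q_neg, mul_comm]

lemma separation {K : ℕ} {z : ℕ → ℝ} {δ : ℝ} (hz : ∀ l, l + 1 < K → δ ≤ z (l + 1) - z l)
    (i n : ℕ) (h : i + n < K) : n * δ ≤ z (i + n) - z i := by
  induction n with
  | zero => simp
  | succ n ih =>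
    have h1 := ih (by omega)
    have h2 := hz (i + n) (by omega)
    rw [← add_assoc]
    push_cast
    linarith

lemma mul_le_abs_add_abs {K : ℕ} {z : ℕ → ℝ} {δ : ℝ} (hδ : 0 ≤ δ)
    (hz : ∀ l, l + 1 < K → δ ≤ z (l + 1) - z l) (x : ℝ) {i j n : ℕ} (hi : i < K) (hj : j < K)
    (h : i + n ≤ j ∨ j + n ≤ i) : n * δ ≤ |x - z i| + |x - z j| := by
  have key : ∀ i j, j < K → i + n ≤ j → n * δ ≤ |x - z i| + |x - z j| := by
    intro i j hj h
    obtain ⟨m, rfl⟩ := Nat.exists_eq_add_of_le (show i ≤ j by omega)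
    have h1 := separation hz i m hj
    have h2 : (n : ℝ) ≤ m := by exact_mod_cast (by omega : n ≤ m)
    have h3 := le_abs_self (x - z i)
    have h4 := neg_le_abs (x - z (i + m))
    nlinarith
  rcases h with h | h
  · exact key i j hj h
  · rw [add_comm]; exact key j i hi h

/-- Pointwise expansion of the interaction of `Q_k` with its neighbours. -/
lemma abs_interaction_sub_le {p θ : ℝ} (hp : 2 < p) (K : ℕ) (hθ1 : 1 < θ)
    (hθ2 : θ < min (p - 1) (3 / 2)) :
    ∃ C > 0, ∃ ε > 0, ∀ (σ z : ℕ → ℝ) (δ : ℝ), 0 ≤ δ → (∀ k, k < K → |σ k| = 1) →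
      (∀ l, l + 1 < K → δ ≤ z (l + 1) - z l) → ∀ k, 0 < k → k + 1 < K → ∀ x,
      |(f p (∑ j ∈ Finset.range K, σ j * Q p (x - z j)) -
          ∑ j ∈ Finset.range K, f p (σ j * Q p (x - z j))) * (σ k * deriv (Q p) (x - z k)) -
        σ k * cQ p * (σ (k + 1) * Real.exp (x - z (k + 1)) +
          σ (k - 1) * Real.exp (-(x - z (k - 1)))) *
          (p * Q p (x - z k) ^ (p - 1) * deriv (Q p) (x - z k))|
      ≤ C * Real.exp (-θ * δ) * Real.exp (-ε * |x - z k|) := by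
  obtain ⟨hθp, hθ3⟩ := lt_min_iff.1 hθ2
  have hp1 : 1 < p := by linarith
  have hc := cQ_pos hp1
  obtain ⟨C, hC, hN⟩ := abs_f_sum_sub_linear_mul_le hp K
  set ε := min (p - 1 - θ) (1 - θ / 2) with hε
  have hε1 : ε ≤ p - 1 - θ := min_le_left _ _
  have hε2 : ε ≤ 1 - θ / 2 := min_le_right _ _
  have hεpos : 0 < ε := lt_min (by linarith) (by linarith)
  set D := cQ p * (1 + 2 / (p - 1)) with hD
  have hDpos : 0 < D := by
    have : 0 < p - 1 := by linarith
    positivity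
  refine ⟨C * cQ p ^ (p + 1) + (p * cQ p ^ p * D + p * cQ p ^ p * D + p * K * cQ p ^ (p + 1)),
    by positivity, ε, hεpos, ?_⟩
  intro σ z δ hδ hσ hz k hk0 hkK x
  set t : ℕ → ℝ := fun j => |x - z j| with ht
  have ht0 : ∀ j, 0 ≤ t j := fun j => abs_nonneg _
  set u : ℕ → ℝ := fun j => Q p (x - z j) with hu
  have hu0 : ∀ j, 0 < u j := fun j => Q_pos hp1 _
  set a : ℕ → ℝ := fun j => σ j * u j with ha
  have hau : ∀ j, j < K → |a j| = u j := fun j hj => by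
    rw [ha, abs_mul, hσ j hj, one_mul, abs_of_pos (hu0 j)]
  have hkK' : k < K := by omega
  have hone : ∀ i j, i < K → j < K → i ≠ j → δ ≤ t i + t j := fun i j hi hj hij => by
    simpa using mul_le_abs_add_abs hδ hz x (n := 1) hi hj (by omega)
  have htwo : ∀ i j, i < K → j < K → (i + 2 ≤ j ∨ j + 2 ≤ i) → 2 * δ ≤ t i + t j :=
    fun i j hi hj hij => by
      simpa using mul_le_abs_add_abs hδ hz x (n := 2) hi hj hij
  have hexp : ∀ e : ℝ, e ≤ -θ * δ - ε * t k →
      Real.exp e ≤ Real.exp (-θ * δ) * Real.exp (-ε * t k) := fun e he => by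
    rw [← Real.exp_add]; exact Real.exp_le_exp.2 (by linarith)
  set X := Real.exp (-θ * δ) * Real.exp (-ε * t k) with hX
  have hXpos : 0 < X := by positivity
  have hprod : ∀ i j l, (p - 1) * t i + t j + t l ≥ θ * δ + ε * t k →
      u i ^ (p - 1) * (u j * u l) ≤ cQ p ^ (p + 1) * X := fun i j l h => by
    refine (Q_rpow_mul_mul_le hp1 _ _ _).trans ?_
    gcongr
    exact hexp _ (by simp only [ht] at h ⊢; linarith)
  have hnonlin := hN (Finset.range K) a k (cQ p ^ (p + 1) * X) (Finset.card_range K)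
    (Finset.mem_range.2 hkK') (by positivity) ?_ ?_ ?_
  rotate_left
  · intro j hj hjk
    have hj := Finset.mem_range.1 hj
    rw [hau j hj, hau k hkK', sq]
    refine hprod k j j ?_
    nlinarith [hone j k hj hkK' hjk, ht0 j, ht0 k]
  · intro j hj hjk
    have hj := Finset.mem_range.1 hj
    rw [hau j hj, hau k hkK', sq]
    refine hprod j k k ?_
    nlinarith [hone j k hj hkK' hjk, ht0 j, ht0 k]
  · intro i hi j hj hik hjk hij
    have hi := Finset.mem_range.1 hi
    have hj := Finset.mem_range.1 hj
    rw [hau i hi, hau j hj, hau k hkK', mul_assoc]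
    refine hprod i j k ?_
    have h2 : 2 * δ ≤ t i + t j + t k := by
      have := ht0 i
      have := ht0 j
      have := ht0 k
      rcases (by omega : (i + 2 ≤ j ∨ j + 2 ≤ i) ∨ (i + 2 ≤ k ∨ k + 2 ≤ i) ∨
        (j + 2 ≤ k ∨ k + 2 ≤ j)) with h | h | h
      · linarith [htwo i j hi hj h]
      · linarith [htwo i k hi hkK' h]
      · linarith [htwo j k hj hkK' h]
    nlinarith [ht0 i, ht0 j, ht0 k]
  set q := deriv (Q p) (x - z k) with hq
  have hqu : |q| ≤ u k := abs_deriv_Q_le hp1 _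
  set s := Finset.range K
  set w := p * u k ^ (p - 1) * q with hw
  have hwu : |w| ≤ p * u k ^ p := abs_deriv_Q_rpow_le hp1 _
  have hσk : |σ k| = 1 := hσ k hkK'
  set R := f p (∑ j ∈ s, a j) - ∑ j ∈ s, f p (a j) with hR
  set rest := ((s.erase k).erase (k + 1)).erase (k - 1) with hrest
  have hsum : ∑ j ∈ s.erase k, a j = a (k + 1) + (a (k - 1) + ∑ j ∈ rest, a j) := by
    rw [hrest, Finset.add_sum_erase _ _ (by simp [s]; omega),
      Finset.add_sum_erase _ _ (by simp [s]; omega)]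
  have hnear : ∀ e : ℝ, e ≤ t k - δ →
      p * u k ^ p * (D * Real.exp (θ * e)) ≤ p * cQ p ^ p * D * X := by
    intro e he
    calc p * u k ^ p * (D * Real.exp (θ * e))
        ≤ p * (cQ p ^ p * Real.exp (-p * t k)) * (D * Real.exp (θ * e)) := by
          gcongr; exact Q_rpow_le hp1 _
      _ = p * cQ p ^ p * D * Real.exp (-p * t k + θ * e) := by rw [Real.exp_add]; ring
      _ ≤ p * cQ p ^ p * D * X := by
          gcongr
          refine hexp _ ?_
          nlinarith [ht0 k]
  have hright : |w * (a (k + 1) - σ (k + 1) * (cQ p * Real.exp (x - z (k + 1))))|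
      ≤ p * cQ p ^ p * D * X := by
    rw [← mul_sub, abs_mul w, abs_mul (σ _), hσ _ hkK, one_mul]
    refine le_trans ?_ (hnear (x - z (k + 1)) ?_)
    · exact mul_le_mul hwu (abs_Q_sub_exp_le hp1 hθ1.le (by linarith) _) (abs_nonneg _)
        ((abs_nonneg _).trans hwu)
    · linarith [le_abs_self (x - z k), hz k hkK]
  have hleft : |w * (a (k - 1) - σ (k - 1) * (cQ p * Real.exp (-(x - z (k - 1)))))|
      ≤ p * cQ p ^ p * D * X := by
    rw [← mul_sub, abs_mul w, abs_mul (σ _), hσ _ (by omega), one_mul]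
    refine le_trans ?_ (hnear (-(x - z (k - 1))) ?_)
    · have := abs_Q_sub_exp_le hp1 hθ1.le (by linarith) (-(x - z (k - 1)))
      rw [Q_neg] at this
      exact mul_le_mul hwu this (abs_nonneg _) ((abs_nonneg _).trans hwu)
    · have h := hz (k - 1) (by omega)
      rw [Nat.sub_add_cancel hk0] at h
      linarith [neg_le_abs (x - z k)]
  have hfar : |w * ∑ j ∈ rest, a j| ≤ p * K * cQ p ^ (p + 1) * X := by
    rw [Finset.mul_sum]
    refine (Finset.abs_sum_le_sum_abs _ _).trans ?_
    have hb : ∀ j ∈ rest, |w * a j| ≤ p * (cQ p ^ (p + 1) * X) := by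
      intro j hj
      simp only [hrest, s, Finset.mem_erase, Finset.mem_range] at hj
      obtain ⟨hj1, hj2, hj3, hjK⟩ := hj
      rw [abs_mul, hau j hjK]
      calc |w| * u j ≤ p * u k ^ p * u j := by have := hu0 j; gcongr
        _ = p * (u k ^ (p - 1) * (u k * u j)) := by
            rw [← mul_assoc (u k ^ (p - 1)), ← Real.rpow_add_one (hu0 k).ne', sub_add_cancel]; ring
        _ ≤ p * (cQ p ^ (p + 1) * X) := by
            refine mul_le_mul_of_nonneg_left (hprod k k j ?_) (by linarith)
            nlinarith [htwo k j hkK' hjK (by omega), ht0 j, ht0 k]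
    refine (Finset.sum_le_card_nsmul _ _ _ hb).trans ?_
    rw [nsmul_eq_mul]
    have hcard : (rest.card : ℝ) ≤ K := by
      have : rest ⊆ s := (Finset.erase_subset _ _).trans
        ((Finset.erase_subset _ _).trans (Finset.erase_subset _ _))
      have := Finset.card_le_card this
      rw [Finset.card_range] at this
      exact_mod_cast this
    calc rest.card * (p * (cQ p ^ (p + 1) * X)) ≤ K * (p * (cQ p ^ (p + 1) * X)) := by gcongr
      _ = _ := by ring
  have hfirst : |(R - p * u k ^ (p - 1) * ∑ j ∈ s.erase k, a j) * q|
      ≤ C * (cQ p ^ (p + 1) * X) := by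
    rw [hau k hkK'] at hnonlin
    rw [abs_mul]
    refine le_trans ?_ hnonlin
    gcongr
  have hdecomp : R * (σ k * q) - σ k * cQ p * (σ (k + 1) * Real.exp (x - z (k + 1)) +
      σ (k - 1) * Real.exp (-(x - z (k - 1)))) * w =
      σ k * ((R - p * u k ^ (p - 1) * ∑ j ∈ s.erase k, a j) * q
        + (w * (a (k + 1) - σ (k + 1) * (cQ p * Real.exp (x - z (k + 1))))
        + w * (a (k - 1) - σ (k - 1) * (cQ p * Real.exp (-(x - z (k - 1)))))
        + w * ∑ j ∈ rest, a j)) := by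
    rw [hsum, hw]; ring
  rw [hdecomp, abs_mul, hσk, one_mul, mul_assoc _ (Real.exp _)]
  refine (abs_add_le _ _).trans ?_
  refine (add_le_add hfirst ((abs_add_le _ _).trans (add_le_add ((abs_add_le _ _).trans
    (add_le_add hright hleft)) hfar))).trans (le_of_eq ?_)
  ring

lemma continuous_f {p : ℝ} (hp : 2 < p) : Continuous (f p) :=
  continuous_iff_continuousAt.2 fun x => (hasDerivAt_f hp x).continuousAt

theorem leading_order_interaction (p : ℝ) (hp : 2 < p) (K : ℕ) (hK : 3 ≤ K)
    (θ : ℝ) (hθ1 : 1 < θ) (hθ2 : θ < min (p - 1) (3 / 2)) :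
    ∃ C > 0, ∃ r₀ > 0, ∀ σ z : ℕ → ℝ,
      (∀ k, k < K → σ k = 1 ∨ σ k = -1) →
      (∀ l, l + 1 < K → z l < z (l + 1)) →
      (∀ l, l + 1 < K → r₀ ≤ z (l + 1) - z l) →
      ∀ k, 0 < k → k + 1 < K →
        |(∫ x : ℝ,
            (f p (∑ j ∈ Finset.range K, σ j * Q p (x - z j)) -
              ∑ j ∈ Finset.range K, f p (σ j * Q p (x - z j))) *
              (σ k * deriv (Q p) (x - z k))) -
          c₁ p * κ p * σ k *
            (σ (k - 1) * Real.exp (-(z k - z (k - 1))) -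
              σ (k + 1) * Real.exp (-(z (k + 1) - z k)))|
        ≤ C * ∑ l ∈ Finset.range (K - 1), Real.exp (-θ * (z (l + 1) - z l)) := by
  have hp1 : 1 < p := by linarith
  obtain ⟨C, hC, ε, hε, hbound⟩ := abs_interaction_sub_le hp K hθ1 hθ2
  have hIε := integrable_exp_neg_mul_abs hε
  set J := ∫ x : ℝ, Real.exp (-ε * |x|) with hJ
  have hJ0 : 0 ≤ J := integral_nonneg fun x => (Real.exp_pos _).le
  refine ⟨C * (J + 1), by positivity, 1, one_pos, ?_⟩
  intro σ z hσ _ hz k hk0 hkK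
  obtain ⟨m, hm, hmin⟩ := Finset.exists_min_image (Finset.range (K - 1))
    (fun l => z (l + 1) - z l) ⟨0, Finset.mem_range.2 (by omega)⟩
  have hmK := Finset.mem_range.1 hm
  set δ := z (m + 1) - z m with hδ
  have hδ0 : 0 ≤ δ := zero_le_one.trans (hz m (by omega))
  have hpt := hbound σ z δ hδ0
    (fun k hk => by rcases hσ k hk with h | h <;> simp [h])
    (fun l hl => hmin l (Finset.mem_range.2 (by omega))) k hk0 hkK
  set H : ℝ → ℝ := fun x => (f p (∑ j ∈ Finset.range K, σ j * Q p (x - z j)) -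
      ∑ j ∈ Finset.range K, f p (σ j * Q p (x - z j))) * (σ k * deriv (Q p) (x - z k)) with hH
  set M : ℝ → ℝ := fun x => σ k * cQ p * (σ (k + 1) * Real.exp (x - z (k + 1)) +
      σ (k - 1) * Real.exp (-(x - z (k - 1)))) *
      (p * Q p (x - z k) ^ (p - 1) * deriv (Q p) (x - z k)) with hM
  set I := ∫ x : ℝ, Q p x ^ p * Real.exp (-x) with hI
  set g : ℝ → ℝ := fun y => p * Q p y ^ (p - 1) * deriv (Q p) y with hg
  have hpos_int : Integrable fun y => Real.exp (1 * y) * g y :=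
    integrable_exp_mul_deriv_Q_rpow hp1 (by simpa using hp1)
  have hneg_int : Integrable fun y => Real.exp (-1 * y) * g y :=
    integrable_exp_mul_deriv_Q_rpow hp1 (by simpa using hp1)
  have hpos_val : ∫ y, Real.exp (1 * y) * g y = -I := by
    rw [hg, integral_exp_mul_deriv_Q_rpow hp1 (by simpa using hp1), integral_exp_mul_Q_rpow,
      one_mul]
  have hneg_val : ∫ y, Real.exp (-1 * y) * g y = I := by
    rw [hg, integral_exp_mul_deriv_Q_rpow hp1 (by simpa using hp1), hI]
    simp [mul_comm]
  set A := σ k * cQ p * σ (k + 1) * Real.exp (-(z (k + 1) - z k)) with hA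
  set B := σ k * cQ p * σ (k - 1) * Real.exp (-(z k - z (k - 1))) with hB
  have hMeq : M = fun x => A * (Real.exp (1 * (x - z k)) * g (x - z k)) +
      B * (Real.exp (-1 * (x - z k)) * g (x - z k)) := by
    funext x
    have e1 : Real.exp (x - z (k + 1)) =
        Real.exp (-(z (k + 1) - z k)) * Real.exp (1 * (x - z k)) := by
      rw [← Real.exp_add]; congr 1; ring
    have e2 : Real.exp (-(x - z (k - 1))) =
        Real.exp (-(z k - z (k - 1))) * Real.exp (-1 * (x - z k)) := by
      rw [← Real.exp_add]; congr 1; ring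
    simp only [hM, e1, e2, hA, hB, hg]
    ring
  have hint1 := (hpos_int.comp_sub_right (z k)).const_mul A
  have hint2 := (hneg_int.comp_sub_right (z k)).const_mul B
  have hM_int : Integrable M := by rw [hMeq]; exact hint1.add hint2
  have hM_val : ∫ x, M x = c₁ p * κ p * σ k *
      (σ (k - 1) * Real.exp (-(z k - z (k - 1))) -
        σ (k + 1) * Real.exp (-(z (k + 1) - z k))) := by
    rw [hMeq, integral_add hint1 hint2, integral_const_mul, integral_const_mul,
      integral_sub_right_eq_self (fun y => Real.exp (1 * y) * g y),
      integral_sub_right_eq_self (fun y => Real.exp (-1 * y) * g y), hpos_val, hneg_val]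
    have hκ : c₁ p * κ p = cQ p * I := by
      rw [κ, ← hI, ← mul_assoc, mul_div_cancel₀ _ (c₁_pos hp1).ne']
    rw [hκ, hA, hB]
    ring
  have hdom : Integrable fun x => C * Real.exp (-θ * δ) * Real.exp (-ε * |x - z k|) :=
    (hIε.comp_sub_right (z k)).const_mul _
  have hdiff : Integrable fun x => H x - M x := by
    have hQc := continuous_Q hp1
    have hQc' := continuous_deriv_Q hp1
    have hfc := continuous_f hp
    have hHc : Continuous H := by
      simp only [hH]
      fun_prop
    exact hdom.mono' (hHc.aestronglyMeasurable.sub hM_int.aestronglyMeasurable)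
      (Filter.Eventually.of_forall hpt)
  have hH_int : ∫ x, H x = (∫ x, (H x - M x)) + ∫ x, M x := by
    rw [← integral_add hdiff hM_int]
    simp only [sub_add_cancel]
  rw [hH_int, hM_val, add_sub_cancel_right]
  calc |∫ x, (H x - M x)| ≤ ∫ x, C * Real.exp (-θ * δ) * Real.exp (-ε * |x - z k|) :=
        (Real.norm_eq_abs _).symm.le.trans
          (norm_integral_le_of_norm_le hdom (Filter.Eventually.of_forall hpt))
    _ = C * Real.exp (-θ * δ) * J := by
        rw [integral_const_mul, integral_sub_right_eq_self (fun y => Real.exp (-ε * |y|))]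
    _ ≤ C * (J + 1) * Real.exp (-θ * δ) := by
        nlinarith [mul_pos hC (Real.exp_pos (-θ * δ))]
    _ ≤ _ := by
        gcongr
        exact Finset.single_le_sum (f := fun l => Real.exp (-θ * (z (l + 1) - z l)))
          (fun l _ => (Real.exp_pos _).le) hm
end

section
/- Let p > 2. There exist a real number ν₀ > 0 and a smooth function Y : ℝ → ℝ with ∫_ℝ Y(x)² dx = 1 such that −Y''(x) + Y(x) − p·Q(x)^(p−1)·Y(x) = −ν₀²·Y(x) for all x ∈ ℝ, and for every n ∈ ℕ there exists C_n > 0 with |Y^(n)(x)| ≤ C_n·e^(−√(1+ν₀²)·|x|) for all x ∈ ℝ. Moreover, if μ > 0 and Z : ℝ → ℝ is a nonzero twice continuously differentiable square-integrable function satisfying −Z'' + Z − p·Q^(p−1)·Z = −μ²·Z on ℝ, then μ = ν₀ and Z is a scalar multiple of Y. -/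
open MeasureTheory

section HyperbolicFunctions

lemma hasDerivAt_tanh_mul (a x : ℝ) :
    HasDerivAt (fun x => Real.tanh (a * x)) (a * (1 - Real.tanh (a * x) ^ 2)) x := by
  have hl : HasDerivAt (fun x : ℝ => a * x) a x := by
    simpa using (hasDerivAt_id x).const_mul a
  have hc : Real.cosh (a * x) ≠ 0 := (Real.cosh_pos _).ne'
  have h := hl.sinh.div hl.cosh hc
  have he : (fun x => Real.tanh (a * x)) =
      (fun x => Real.sinh (a * x)) / fun x => Real.cosh (a * x) := by
    ext y
    simp [Real.tanh_eq_sinh_div_cosh]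
  rw [he]
  convert! h using 1
  rw [Real.tanh_eq_sinh_div_cosh]
  field_simp

lemma one_sub_tanh_sq (y : ℝ) : 1 - Real.tanh y ^ 2 = 1 / Real.cosh y ^ 2 := by
  have hc : Real.cosh y ≠ 0 := (Real.cosh_pos _).ne'
  rw [Real.tanh_eq_sinh_div_cosh]
  field_simp
  linarith [Real.cosh_sq y]

lemma exp_abs_div_two_le_cosh (y : ℝ) : Real.exp |y| / 2 ≤ Real.cosh y := by
  rw [← Real.cosh_abs, Real.cosh_eq]
  linarith [Real.exp_pos (-|y|)]

lemma one_sub_tanh_sq_le {y : ℝ} (hy : 0 < y) : 1 - Real.tanh y ^ 2 ≤ 2 / y := by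
  have h1 := Real.one_le_cosh y
  have h2 := exp_abs_div_two_le_cosh y
  have h3 := Real.add_one_le_exp |y|
  rw [abs_of_pos hy] at h2 h3
  rw [one_sub_tanh_sq, div_le_div_iff₀ (by positivity) hy]
  nlinarith

end HyperbolicFunctions

lemma Q_rpow_sub_one {p : ℝ} (hp : 2 < p) (x : ℝ) :
    Q p x ^ (p - 1) = (p + 1) / 2 * (1 - Real.tanh ((p - 1) / 2 * x) ^ 2) := by
  have hc := Real.cosh_pos ((p - 1) / 2 * x)
  have hp1 : p - 1 ≠ 0 := by linarith
  rw [Q, ← Real.rpow_mul (by positivity), one_div_mul_cancel hp1, Real.rpow_one, one_sub_tanh_sq]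
  field_simp

section BoundState

/-- The positive eigenfunction `cosh (a x) ^ (-(a + 1) / a)` before normalization. -/
noncomputable def boundState (a x : ℝ) : ℝ :=
  Real.exp (-((a + 1) / a) * Real.log (Real.cosh (a * x)))

variable {a : ℝ}

lemma boundState_pos (x : ℝ) : 0 < boundState a x := Real.exp_pos _

lemma contDiff_boundState : ContDiff ℝ (⊤ : ℕ∞) (boundState a) := by
  unfold boundState
  have h : ContDiff ℝ (⊤ : ℕ∞) fun x => Real.cosh (a * x) :=
    Real.contDiff_cosh.comp (contDiff_const.mul contDiff_id)
  exact Real.contDiff_exp.comp (contDiff_const.mul (h.log fun x => (Real.cosh_pos _).ne'))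

lemma hasDerivAt_boundState (ha : a ≠ 0) (x : ℝ) :
    HasDerivAt (boundState a) (-(a + 1) * Real.tanh (a * x) * boundState a x) x := by
  have hl : HasDerivAt (fun x : ℝ => a * x) a x := by
    simpa using (hasDerivAt_id x).const_mul a
  have hc : Real.cosh (a * x) ≠ 0 := (Real.cosh_pos _).ne'
  convert! ((hl.cosh.log hc).const_mul (-((a + 1) / a))).exp using 1
  rw [Real.tanh_eq_sinh_div_cosh, boundState]
  field_simp

lemma boundState_le (ha : 0 < a) (x : ℝ) :
    boundState a x ≤ Real.exp ((a + 1) / a * Real.log 2) * Real.exp (-(a + 1) * |x|) := by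
  rw [boundState, ← Real.exp_add, Real.exp_le_exp]
  have h := Real.log_le_log (by positivity) (exp_abs_div_two_le_cosh (a * x))
  rw [Real.log_div (Real.exp_pos _).ne' two_ne_zero, Real.log_exp, abs_mul, abs_of_pos ha] at h
  have hk : 0 < (a + 1) / a := by positivity
  have hm : (a + 1) / a * (a * |x| - Real.log 2) ≤ (a + 1) / a * Real.log (Real.cosh (a * x)) :=
    mul_le_mul_of_nonneg_left h hk.le
  have he : (a + 1) / a * (a * |x|) = (a + 1) * |x| := by field_simp
  linarith

lemma integrable_boundState_sq (ha : 0 < a) : Integrable fun x => boundState a x ^ 2 := by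
  set K := Real.exp ((a + 1) / a * Real.log 2) with hK
  refine Integrable.mono' (integrable_inv_one_add_sq.const_mul (K ^ 2))
    (contDiff_boundState.continuous.pow 2).aestronglyMeasurable (.of_forall fun x => ?_)
  have hexp : Real.exp (-(a + 1) * |x|) ^ 2 ≤ (1 + x ^ 2)⁻¹ := by
    have h1 : 1 + |x| ≤ Real.exp ((a + 1) * |x|) := by
      nlinarith [Real.add_one_le_exp ((a + 1) * |x|), abs_nonneg x]
    rw [neg_mul, Real.exp_neg, inv_pow]
    gcongr
    nlinarith [abs_nonneg x, sq_abs x]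
  rw [Real.norm_of_nonneg (sq_nonneg _)]
  calc boundState a x ^ 2 ≤ (K * Real.exp (-(a + 1) * |x|)) ^ 2 :=
        pow_le_pow_left₀ (boundState_pos x).le (boundState_le ha x) 2
    _ = K ^ 2 * Real.exp (-(a + 1) * |x|) ^ 2 := mul_pow ..
    _ ≤ _ := by gcongr

lemma integral_boundState_sq_pos (ha : 0 < a) : 0 < ∫ x, boundState a x ^ 2 := by
  rw [integral_pos_iff_support_of_nonneg (fun x => sq_nonneg _) (integrable_boundState_sq ha)]
  have : (Function.support fun x => boundState a x ^ 2) = Set.univ := by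
    ext x
    simpa using (boundState_pos x).ne'
  simp [this]

/-- Every derivative of the bound state is a polynomial in `tanh (a x)` times the bound state. -/
lemma exists_iteratedDeriv_boundState (ha : a ≠ 0) (n : ℕ) :
    ∃ P : Polynomial ℝ, iteratedDeriv n (boundState a) =
      fun x => P.eval (Real.tanh (a * x)) * boundState a x := by
  induction n with
  | zero => exact ⟨1, by simp⟩
  | succ n ih =>
    obtain ⟨P, hP⟩ := ih
    refine ⟨Polynomial.C a * (1 - Polynomial.X ^ 2) * P.derivative
      - Polynomial.C (a + 1) * Polynomial.X * P, ?_⟩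
    rw [iteratedDeriv_succ, hP]
    ext x
    have h := ((P.hasDerivAt (Real.tanh (a * x))).comp x (hasDerivAt_tanh_mul a x)).mul
      (hasDerivAt_boundState ha x)
    refine h.deriv.trans ?_
    simp only [Function.comp_apply, Polynomial.eval_sub, Polynomial.eval_mul, Polynomial.eval_C,
      Polynomial.eval_one, Polynomial.eval_pow, Polynomial.eval_X]
    ring

lemma exists_abs_iteratedDeriv_boundState_le (ha : 0 < a) (n : ℕ) :
    ∃ C > 0, ∀ x, |iteratedDeriv n (boundState a) x| ≤ C * Real.exp (-(a + 1) * |x|) := by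
  obtain ⟨P, hP⟩ := exists_iteratedDeriv_boundState ha.ne' n
  obtain ⟨M, hM⟩ := (isCompact_Icc (a := (-1 : ℝ)) (b := 1)).exists_bound_of_continuousOn
    P.continuous.continuousOn
  have hM0 : 0 ≤ M := (norm_nonneg _).trans (hM 0 (by norm_num))
  refine ⟨(M + 1) * Real.exp ((a + 1) / a * Real.log 2), by positivity, fun x => ?_⟩
  have ht := abs_le.mp (Real.abs_tanh_lt_one (a * x)).le
  have hPx : |P.eval (Real.tanh (a * x))| ≤ M + 1 := by
    linarith [hM _ ⟨ht.1, ht.2⟩, Real.norm_eq_abs (P.eval (Real.tanh (a * x)))]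
  rw [hP, abs_mul, abs_of_pos (boundState_pos x), mul_assoc]
  exact mul_le_mul hPx (boundState_le ha x) (boundState_pos x).le (by positivity)

end BoundState

section Uniqueness

lemma exists_forall_one_le_of_deriv_ge {f f' : ℝ → ℝ} {N d : ℝ} (hd : 0 < d)
    (hf : ∀ x, HasDerivAt f (f' x) x) (hf' : ∀ x, N ≤ x → d ≤ f' x) :
    ∃ M, N ≤ M ∧ ∀ x, M ≤ x → 1 ≤ f x := by
  have hle := (convex_Ici N).mul_sub_le_image_sub_of_le_deriv (f := f) (C := d)
    (fun x _ => (hf x).continuousAt.continuousWithinAt)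
    (fun x _ => (hf x).differentiableAt.differentiableWithinAt)
    (fun x hx => by
      rw [interior_Ici, Set.mem_Ioi] at hx
      rw [(hf x).deriv]
      exact hf' x hx.le)
  refine ⟨N + (1 + |f N|) / d, by linarith [show 0 ≤ (1 + |f N|) / d by positivity],
    fun x hx => ?_⟩
  have hNx : N ≤ x := by linarith [show 0 ≤ (1 + |f N|) / d by positivity]
  have h := hle N (Set.mem_Ici.mpr le_rfl) x hNx hNx
  have h2 : d * ((1 + |f N|) / d) ≤ d * (x - N) := by gcongr; linarith
  rw [mul_div_cancel₀ _ hd.ne'] at h2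
  linarith [neg_abs_le (f N)]

/-- A square-integrable solution of `f'' = c f` with `c` bounded below by a positive constant near
`+∞` is small together with its derivative at arbitrarily large times. -/
lemma exists_sq_add_deriv_sq_lt {f f' c : ℝ → ℝ} {R c₀ N ε : ℝ}
    (hf : ∀ x, HasDerivAt f (f' x) x) (hf' : ∀ x, HasDerivAt f' (c x * f x) x)
    (hZint : Integrable fun x => f x ^ 2) (hc₀ : 0 < c₀) (hc : ∀ x, R ≤ x → c₀ ≤ c x)
    (hε : 0 < ε) : ∃ x, N ≤ x ∧ f x ^ 2 + f' x ^ 2 < ε := by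
  by_contra! hcon
  have hm : 0 < min 1 c₀ := lt_min one_pos hc₀
  obtain ⟨M₁, -, hM₁⟩ := exists_forall_one_le_of_deriv_ge (N := max R N) (mul_pos hm hε)
    (fun x => (hf x).mul (hf' x)) (fun x hx => by
      have h1 := hc x (le_trans (le_max_left _ _) hx)
      have h2 := hcon x (le_trans (le_max_right _ _) hx)
      have h3 : min 1 c₀ * ε ≤ min 1 c₀ * (f x ^ 2 + f' x ^ 2) := by gcongr
      have h4 : min 1 c₀ * f x ^ 2 ≤ c x * f x ^ 2 := by
        gcongr; exact (min_le_right _ _).trans h1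
      have h5 : min 1 c₀ * f' x ^ 2 ≤ 1 * f' x ^ 2 := by
        gcongr; exact min_le_left _ _
      linarith)
  obtain ⟨M₂, -, hM₂⟩ := exists_forall_one_le_of_deriv_ge (N := M₁) two_pos
    (fun x => (hf x).mul (hf x)) (fun x hx => by
      have := hM₁ x hx
      simp only [Pi.mul_apply] at this
      linarith)
  have hfin := hZint.measure_norm_ge_lt_top one_pos
  have hsub : Set.Ici M₂ ⊆ {x | 1 ≤ ‖f x ^ 2‖} := fun x hx => by
    have := hM₂ x hx
    simp only [Pi.mul_apply] at this
    rw [Set.mem_ofPred_eq, Real.norm_of_nonneg (sq_nonneg _)]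
    linarith
  have := (measure_mono hsub).trans_lt hfin
  simp at this

variable {a μ : ℝ} {Z dZ : ℝ → ℝ}

/-- The solution transformed by the first-order operator annihilating the bound state. -/
noncomputable def darboux (a : ℝ) (Z dZ : ℝ → ℝ) (x : ℝ) : ℝ :=
  dZ x + (a + 1) * Real.tanh (a * x) * Z x

/-- The second Darboux step: `dU + tanh (a x) U`, where `dU` is the derivative of
`U = darboux a Z dZ`. -/
noncomputable def darbouxTwo (a μ : ℝ) (Z dZ : ℝ → ℝ) (x : ℝ) : ℝ :=
  (a + 2) * Real.tanh (a * x) * dZ x +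
    (1 + μ ^ 2 + (a + 1) * Real.tanh (a * x) ^ 2
      - (a + 1) ^ 2 * (1 - Real.tanh (a * x) ^ 2)) * Z x

lemma hasDerivAt_darboux (hZ : ∀ x, HasDerivAt Z (dZ x) x)
    (hZ' : ∀ x, HasDerivAt dZ
      ((1 + μ ^ 2 - (2 * a + 1) * (a + 1) * (1 - Real.tanh (a * x) ^ 2)) * Z x) x) (x : ℝ) :
    HasDerivAt (darboux a Z dZ)
      (darbouxTwo a μ Z dZ x - Real.tanh (a * x) * darboux a Z dZ x) x := by
  convert! (hZ' x).add (((hasDerivAt_tanh_mul a x).const_mul (a + 1)).mul (hZ x)) using 1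
  simp only [darboux, darbouxTwo]
  ring

lemma hasDerivAt_darbouxTwo (hZ : ∀ x, HasDerivAt Z (dZ x) x)
    (hZ' : ∀ x, HasDerivAt dZ
      ((1 + μ ^ 2 - (2 * a + 1) * (a + 1) * (1 - Real.tanh (a * x) ^ 2)) * Z x) x) (x : ℝ) :
    HasDerivAt (darbouxTwo a μ Z dZ)
      (Real.tanh (a * x) * darbouxTwo a μ Z dZ x + μ ^ 2 * darboux a Z dZ x) x := by
  have hT := hasDerivAt_tanh_mul a x
  convert! ((hT.const_mul (a + 2)).mul (hZ' x)).add
    ((((hT.pow 2).const_mul (a + 1)).const_add (1 + μ ^ 2)).sub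
      (((hT.pow 2).const_sub 1).const_mul ((a + 1) ^ 2)) |>.mul (hZ x)) using 1
  simp only [darboux, darbouxTwo, Pi.pow_apply, Pi.sub_apply]
  ring

lemma abs_add_mul_le {b c K u v : ℝ} (hb : |b| ≤ K) (hc : |c| ≤ K) :
    |b * u + c * v| ≤ K * (|u| + |v|) := by
  calc |b * u + c * v| ≤ |b| * |u| + |c| * |v| := by
        simpa only [abs_mul] using abs_add_le (b * u) (c * v)
    _ ≤ K * |u| + K * |v| := by gcongr
    _ = K * (|u| + |v|) := by ring

lemma darboux_mul_darbouxTwo_le (ha : 0 < a) (x : ℝ) :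
    darboux a Z dZ x * darbouxTwo a μ Z dZ x ≤
      2 * (a + μ ^ 2 + 2) ^ 4 * (Z x ^ 2 + dZ x ^ 2) := by
  set K := (a + μ ^ 2 + 2) ^ 2 with hK
  have hμ := sq_nonneg μ
  have hK1 : a + μ ^ 2 + 2 ≤ K := by nlinarith
  have hK2 : (a + 1) ^ 2 ≤ K := pow_le_pow_left₀ (by linarith) (by linarith) 2
  have ht := (Real.abs_tanh_lt_one (a * x)).le
  have ht2 := (Real.tanh_sq_lt_one (a * x)).le
  have ht0 := sq_nonneg (Real.tanh (a * x))
  have hU : |darboux a Z dZ x| ≤ K * (|dZ x| + |Z x|) := by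
    rw [darboux, ← one_mul (dZ x), abs_mul 1, abs_one, one_mul |_|]
    refine abs_add_mul_le (by rw [abs_one]; linarith) ?_
    rw [abs_mul, abs_of_pos (by linarith)]
    nlinarith [abs_nonneg (Real.tanh (a * x))]
  have hW : |darbouxTwo a μ Z dZ x| ≤ K * (|dZ x| + |Z x|) := by
    refine abs_add_mul_le ?_ (abs_le.mpr ⟨?_, ?_⟩)
    · rw [abs_mul, abs_of_pos (by linarith)]
      nlinarith [abs_nonneg (Real.tanh (a * x))]
    · nlinarith [mul_nonneg (sq_nonneg (a + 1)) ht0]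
    · nlinarith [mul_nonneg (sq_nonneg (a + 1)) (sub_nonneg.mpr ht2)]
  calc darboux a Z dZ x * darbouxTwo a μ Z dZ x
      ≤ |darboux a Z dZ x| * |darbouxTwo a μ Z dZ x| := by
        rw [← abs_mul]; exact le_abs_self _
    _ ≤ (K * (|dZ x| + |Z x|)) * (K * (|dZ x| + |Z x|)) := by gcongr
    _ = K ^ 2 * (|dZ x| + |Z x|) ^ 2 := by ring
    _ ≤ K ^ 2 * (2 * (|dZ x| ^ 2 + |Z x| ^ 2)) := by gcongr; exact add_sq_le
    _ = _ := by rw [sq_abs, sq_abs, hK]; ring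

lemma darboux_mul_darbouxTwo_nonpos (ha : 0 < a) (hμ : 0 < μ)
    (hZ : ∀ x, HasDerivAt Z (dZ x) x)
    (hZ' : ∀ x, HasDerivAt dZ
      ((1 + μ ^ 2 - (2 * a + 1) * (a + 1) * (1 - Real.tanh (a * x) ^ 2)) * Z x) x)
    (hZint : Integrable fun x => Z x ^ 2) (x₀ : ℝ) :
    darboux a Z dZ x₀ * darbouxTwo a μ Z dZ x₀ ≤ 0 := by
  by_contra! hpos
  have hG : ∀ x, HasDerivAt (fun x => darboux a Z dZ x * darbouxTwo a μ Z dZ x)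
      (darbouxTwo a μ Z dZ x ^ 2 + μ ^ 2 * darboux a Z dZ x ^ 2) x := fun x => by
    convert! (hasDerivAt_darboux hZ hZ' x).mul (hasDerivAt_darbouxTwo hZ hZ' x) using 1
    ring
  have hmono : Monotone fun x => darboux a Z dZ x * darbouxTwo a μ Z dZ x :=
    monotone_of_deriv_nonneg (fun x => (hG x).differentiableAt) fun x => by
      rw [(hG x).deriv]; positivity
  obtain ⟨x, hx, hlt⟩ := exists_sq_add_deriv_sq_lt (N := x₀)
    (R := 2 * ((2 * a + 1) * (a + 1)) / a) (c₀ := μ ^ 2)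
    (ε := darboux a Z dZ x₀ * darbouxTwo a μ Z dZ x₀ / (2 * (a + μ ^ 2 + 2) ^ 4))
    hZ hZ' hZint (by positivity) (fun x hx => by
      have hx' : 2 * ((2 * a + 1) * (a + 1)) ≤ a * x := by
        rw [div_le_iff₀ ha] at hx; linarith
      have hax : 0 < a * x := lt_of_lt_of_le (by positivity) hx'
      have h1 : (2 * a + 1) * (a + 1) * (1 - Real.tanh (a * x) ^ 2) ≤
          (2 * a + 1) * (a + 1) * (2 / (a * x)) := by
        gcongr; exact one_sub_tanh_sq_le hax
      have h2 : (2 * a + 1) * (a + 1) * (2 / (a * x)) ≤ 1 := by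
        rw [← mul_div_assoc, div_le_one hax]; linarith
      linarith) (by positivity)
  rw [lt_div_iff₀ (by positivity)] at hlt
  have h1 := hmono hx
  have h2 := darboux_mul_darbouxTwo_le (μ := μ) (Z := Z) (dZ := dZ) ha x
  simp only at h1
  linarith

lemma darboux_eq_zero (ha : 0 < a) (hμ : 0 < μ)
    (hZ : ∀ x, HasDerivAt Z (dZ x) x)
    (hZ' : ∀ x, HasDerivAt dZ
      ((1 + μ ^ 2 - (2 * a + 1) * (a + 1) * (1 - Real.tanh (a * x) ^ 2)) * Z x) x)
    (hZint : Integrable fun x => Z x ^ 2) (x : ℝ) :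
    darboux a Z dZ x = 0 := by
  have hzero : ∀ x, darboux a Z dZ x * darbouxTwo a μ Z dZ x = 0 := fun x => by
    refine le_antisymm (darboux_mul_darbouxTwo_nonpos ha hμ hZ hZ' hZint x) ?_
    have h := darboux_mul_darbouxTwo_nonpos (Z := fun x => Z (-x)) (dZ := fun x => -dZ (-x)) ha hμ
      (fun x => by
        convert! (hZ (-x)).scomp x (hasDerivAt_neg x) using 1
        simp)
      (fun x => by
        convert! ((hZ' (-x)).scomp x (hasDerivAt_neg x)).neg using 1
        simp)
      hZint.comp_neg (-x)
    simp only [darboux, darbouxTwo, mul_neg, Real.tanh_neg, neg_neg, neg_sq] at h ⊢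
    linarith
  have hG := (hasDerivAt_darboux hZ hZ' x).mul (hasDerivAt_darbouxTwo hZ hZ' x)
  have h0 : HasDerivAt (darboux a Z dZ * darbouxTwo a μ Z dZ) 0 x := by
    rw [show darboux a Z dZ * darbouxTwo a μ Z dZ = fun _ => 0 from funext hzero]
    exact hasDerivAt_const x 0
  have h := hG.unique h0
  have hU : (μ * darboux a Z dZ x) ^ 2 = 0 := by
    nlinarith [sq_nonneg (darbouxTwo a μ Z dZ x), sq_nonneg (μ * darboux a Z dZ x)]
  simpa [hμ.ne'] using hU

lemma exists_eq_mul_boundState (ha : a ≠ 0) (hZ : ∀ x, HasDerivAt Z (dZ x) x)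
    (h : ∀ x, darboux a Z dZ x = 0) : ∃ c, ∀ x, Z x = c * boundState a x := by
  have hd : ∀ x, HasDerivAt (fun x => Z x / boundState a x) 0 x := fun x => by
    convert! (hZ x).div (hasDerivAt_boundState ha x) (boundState_pos x).ne' using 1
    have hx := h x
    rw [darboux] at hx
    rw [show dZ x = -(a + 1) * Real.tanh (a * x) * Z x by linarith]
    ring
  refine ⟨Z 0 / boundState a 0, fun x => ?_⟩
  have := is_const_of_deriv_eq_zero (fun x => (hd x).differentiableAt) (fun x => (hd x).deriv) x 0
  rw [← this, div_mul_cancel₀ _ (boundState_pos x).ne']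

end Uniqueness

lemma deriv_const_mul_boundState {a : ℝ} (ha : a ≠ 0) (A : ℝ) :
    deriv (fun x => A * boundState a x) =
      fun x => A * (-(a + 1) * Real.tanh (a * x) * boundState a x) :=
  funext fun x => ((hasDerivAt_boundState ha x).const_mul A).deriv

lemma deriv_deriv_const_mul_boundState {a : ℝ} (ha : a ≠ 0) (A x : ℝ) :
    deriv (deriv fun x => A * boundState a x) x =
      ((a + 1) ^ 2 - (2 * a + 1) * (a + 1) * (1 - Real.tanh (a * x) ^ 2))
        * (A * boundState a x) := by
  rw [deriv_const_mul_boundState ha]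
  refine ((((hasDerivAt_tanh_mul a x).const_mul (-(a + 1))).mul
    (hasDerivAt_boundState ha x)).const_mul A).deriv.trans ?_
  ring

theorem linearized_operator_negative_eigenvalue (p : ℝ) (hp : 2 < p) :
    ∃ ν₀ : ℝ, 0 < ν₀ ∧ ∃ Y : ℝ → ℝ,
      ContDiff ℝ (⊤ : ℕ∞) Y ∧
      (∫ x : ℝ, Y x ^ 2) = 1 ∧
      (∀ x : ℝ, -(deriv (deriv Y) x) + Y x - p * Q p x ^ (p - 1) * Y x = -(ν₀ ^ 2) * Y x) ∧
      (∀ n : ℕ, ∃ C > 0, ∀ x : ℝ,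
        |iteratedDeriv n Y x| ≤ C * Real.exp (-Real.sqrt (1 + ν₀ ^ 2) * |x|)) ∧
      (∀ μ : ℝ, 0 < μ → ∀ Z : ℝ → ℝ, (∃ x, Z x ≠ 0) →
        ContDiff ℝ 2 Z →
        Integrable (fun x => Z x ^ 2) →
        (∀ x : ℝ, -(deriv (deriv Z) x) + Z x - p * Q p x ^ (p - 1) * Z x = -(μ ^ 2) * Z x) →
        μ = ν₀ ∧ ∃ c : ℝ, ∀ x : ℝ, Z x = c * Y x) := by
  obtain ⟨a, rfl⟩ : ∃ a : ℝ, p = 2 * a + 1 := ⟨(p - 1) / 2, by ring⟩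
  have ha : 0 < a := by linarith
  have hV : ∀ x, (2 * a + 1) * Q (2 * a + 1) x ^ (2 * a + 1 - 1) =
      (2 * a + 1) * (a + 1) * (1 - Real.tanh (a * x) ^ 2) := fun x => by
    rw [Q_rpow_sub_one hp, show (2 * a + 1 - 1) / 2 * x = a * x by ring]
    ring
  have hν : 0 < (a + 1) ^ 2 - 1 := by nlinarith
  have hνsq : √((a + 1) ^ 2 - 1) ^ 2 = (a + 1) ^ 2 - 1 := Real.sq_sqrt hν.le
  have hI := integral_boundState_sq_pos ha
  set A := (√(∫ x, boundState a x ^ 2))⁻¹ with hA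
  have hA0 : 0 < A := by positivity
  refine ⟨√((a + 1) ^ 2 - 1), Real.sqrt_pos.mpr hν, fun x => A * boundState a x,
    contDiff_const.mul contDiff_boundState, ?_, fun x => ?_, fun n => ?_, ?_⟩
  · simp only [mul_pow]
    rw [integral_const_mul, hA, inv_pow, Real.sq_sqrt hI.le, inv_mul_cancel₀ hI.ne']
  · rw [hV, deriv_deriv_const_mul_boundState ha.ne', hνsq]
    ring
  · obtain ⟨C, hC, h⟩ := exists_abs_iteratedDeriv_boundState_le ha n
    refine ⟨A * C, by positivity, fun x => ?_⟩
    rw [hνsq, add_sub_cancel, Real.sqrt_sq (by positivity), iteratedDeriv_const_mul_field,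
      abs_mul, abs_of_pos hA0, mul_assoc]
    gcongr
    exact h x
  · rintro μ hμ Z ⟨x₀, hx₀⟩ hZC hZint hZeq
    have hZ : ∀ x, HasDerivAt Z (deriv Z x) x := fun x =>
      (hZC.differentiable two_ne_zero x).hasDerivAt
    have hZ' : ∀ x, HasDerivAt (deriv Z)
        ((1 + μ ^ 2 - (2 * a + 1) * (a + 1) * (1 - Real.tanh (a * x) ^ 2)) * Z x) x := fun x => by
      have h1 : ContDiff ℝ 1 (deriv Z) := hZC.deriv'
      convert! (h1.differentiable one_ne_zero x).hasDerivAt using 1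
      have := hZeq x
      rw [hV] at this
      linarith
    obtain ⟨c, hc⟩ := exists_eq_mul_boundState ha.ne' hZ (darboux_eq_zero ha hμ hZ hZ' hZint)
    refine ⟨?_, c / A, fun x => ?_⟩
    · have h := (hZ' x₀).deriv
      rw [show Z = fun x => c * boundState a x from funext hc,
        deriv_deriv_const_mul_boundState ha.ne'] at h
      have hne : c * boundState a x₀ ≠ 0 := hc x₀ ▸ hx₀
      have := mul_right_cancel₀ hne h
      rw [eq_comm, Real.sqrt_eq_iff_mul_self_eq hν.le hμ.le]
      linarith
    · rw [hc x, ← mul_assoc, div_mul_cancel₀ _ hA0.ne']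
end
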